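/- arXiv:1801.01394 — 2 statements merged into one kernel-verified Lean document; each statement's English description precedes it below -/
import Mathlib

section
/- Any TREX solution β̂ satisfies ‖β̂‖₁ ≥ ‖β̃(û)‖₁, where β̃(û) is any LASSO solution with tuning parameter λ = û. -/
open Matrix BigOperators Finset

/-- The ℓ1-norm of a vector. -/
noncomputable def norm1 {m : ℕ} (v : Fin m → ℝ) : ℝ := ∑ i, |v i|

/-- The squared ℓ2-norm of a vector. -/
noncomputable def norm2sq {m : ℕ} (v : Fin m → ℝ) : ℝ := ∑ i, (v i) ^ 2

/-- The ℓ2-norm of a vector. -/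
noncomputable def norm2 {m : ℕ} (v : Fin m → ℝ) : ℝ := Real.sqrt (∑ i, (v i) ^ 2)

/-- The ℓ∞ (sup) norm of a vector (the Pi norm on `Fin m → ℝ`). -/
noncomputable def normInf {m : ℕ} (v : Fin m → ℝ) : ℝ := ‖v‖

/-- `b` is a LASSO solution with tuning parameter `lam`:
a minimizer over `β ∈ ℝ^p` of `‖Y − Xβ‖₂² + 2 lam ‖β‖₁`. -/
def IsLassoSol {n p : ℕ} (X : Matrix (Fin n) (Fin p) ℝ) (Y : Fin n → ℝ) (lam : ℝ)
    (b : Fin p → ℝ) : Prop :=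
  ∀ β : Fin p → ℝ,
    norm2sq (Y - X.mulVec b) + 2 * lam * norm1 b ≤
      norm2sq (Y - X.mulVec β) + 2 * lam * norm1 β

/-- The TREX objective with constant `c`. -/
noncomputable def trexObj {n p : ℕ} (X : Matrix (Fin n) (Fin p) ℝ) (Y : Fin n → ℝ)
    (c : ℝ) (β : Fin p → ℝ) : ℝ :=
  norm2sq (Y - X.mulVec β) / (c * normInf (Xᵀ.mulVec (Y - X.mulVec β))) + norm1 β

/-- `b` is a TREX solution: a minimizer of the TREX objective over all `β` with
`Xᵀ(Y − Xβ) ≠ 0` (in particular `û := ‖Xᵀ(Y − Xb)‖∞` is nonzero). -/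
def IsTrexSol {n p : ℕ} (X : Matrix (Fin n) (Fin p) ℝ) (Y : Fin n → ℝ) (c : ℝ)
    (b : Fin p → ℝ) : Prop :=
  Xᵀ.mulVec (Y - X.mulVec b) ≠ 0 ∧
    ∀ β : Fin p → ℝ, Xᵀ.mulVec (Y - X.mulVec β) ≠ 0 →
      trexObj X Y c b ≤ trexObj X Y c β

theorem norm2sq_nonneg {m : ℕ} (v : Fin m → ℝ) : 0 ≤ norm2sq v :=
  Finset.sum_nonneg fun _ _ => sq_nonneg _

theorem norm1_nonneg {m : ℕ} (v : Fin m → ℝ) : 0 ≤ norm1 v :=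
  Finset.sum_nonneg fun _ _ => abs_nonneg _

theorem norm1_smul {m : ℕ} (t : ℝ) (v : Fin m → ℝ) : norm1 (t • v) = |t| * norm1 v := by
  simp [norm1, abs_mul, Finset.mul_sum]

theorem norm2sq_add_smul {m : ℕ} (r w : Fin m → ℝ) (t : ℝ) :
    norm2sq (r + t • w) = norm2sq r + 2 * t * (r ⬝ᵥ w) + t ^ 2 * norm2sq w := by
  simp only [norm2sq, dotProduct, Finset.mul_sum, ← Finset.sum_add_distrib]
  refine Finset.sum_congr rfl fun i _ => ?_
  simp only [Pi.add_apply, Pi.smul_apply, smul_eq_mul]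
  ring

theorem dotProduct_le_normInf_mul_norm1 {m : ℕ} (v w : Fin m → ℝ) :
    v ⬝ᵥ w ≤ normInf v * norm1 w := by
  simp only [dotProduct, norm1, normInf, Finset.mul_sum]
  refine Finset.sum_le_sum fun i _ => (le_abs_self _).trans ?_
  rw [abs_mul]
  exact mul_le_mul_of_nonneg_right (norm_le_pi_norm v i) (abs_nonneg _)

/-- The first-order optimality condition of the LASSO along the ray through the solution. -/
theorem IsLassoSol.mul_norm1_le_dotProduct {n p : ℕ} {X : Matrix (Fin n) (Fin p) ℝ}
    {Y : Fin n → ℝ} {lam : ℝ} {b : Fin p → ℝ} (h : IsLassoSol X Y lam b) :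
    lam * norm1 b ≤ (Xᵀ.mulVec (Y - X.mulVec b)) ⬝ᵥ b := by
  rw [mulVec_transpose, ← dotProduct_mulVec]
  set s := (Y - X.mulVec b) ⬝ᵥ X.mulVec b
  set A := norm2sq (X.mulVec b)
  have hA : 0 ≤ A := norm2sq_nonneg _
  by_contra! hlt
  obtain ⟨d, hd⟩ : ∃ d, d = lam * norm1 b - s := ⟨_, rfl⟩
  have hdpos : 0 < d := by linarith
  obtain ⟨t, ht⟩ : ∃ t, t = d / (A + d) := ⟨_, rfl⟩
  have htpos : 0 < t := ht ▸ by positivity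
  have htA : t * (A + d) = d := by rw [ht]; field_simp
  have ht1 : t ≤ 1 := by rw [ht, div_le_one (by positivity)]; linarith
  have hray := h ((1 - t) • b)
  have hres : Y - X.mulVec ((1 - t) • b) = (Y - X.mulVec b) + t • X.mulVec b := by
    rw [mulVec_smul, sub_smul, one_smul]; abel
  rw [hres, norm2sq_add_smul, norm1_smul, abs_of_nonneg (by linarith : 0 ≤ 1 - t)] at hray
  have hdt : t * (2 * d) ≤ t * (t * A) := by rw [hd]; linarith
  have := le_of_mul_le_mul_left hdt htpos
  nlinarith [mul_pos htpos hdpos]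

/-- At a nonzero LASSO solution the correlation with the residual is at least the tuning
parameter. -/
theorem IsLassoSol.le_normInf {n p : ℕ} {X : Matrix (Fin n) (Fin p) ℝ}
    {Y : Fin n → ℝ} {lam : ℝ} {b : Fin p → ℝ} (h : IsLassoSol X Y lam b) (hb : 0 < norm1 b) :
    lam ≤ normInf (Xᵀ.mulVec (Y - X.mulVec b)) :=
  le_of_mul_le_mul_right
    (h.mul_norm1_le_dotProduct.trans (dotProduct_le_normInf_mul_norm1 _ _)) hb

/-- Lemma 3: any TREX solution `β̂` satisfies `‖β̂‖₁ ≥ ‖β̃(û)‖₁`, where `β̃(û)` is any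
LASSO solution with tuning parameter `λ = û := ‖Xᵀ(Y − Xβ̂)‖∞`. -/
theorem trex_l1_ge_lasso_l1 {n p : ℕ} (X : Matrix (Fin n) (Fin p) ℝ)
    (βs : Fin p → ℝ) (ε Y : Fin n → ℝ) (hY : Y = X.mulVec βs + ε)
    (c : ℝ) (hc : 0 < c) (hc2 : c < 2)
    (bT : Fin p → ℝ) (hbT : IsTrexSol X Y c bT)
    (u : ℝ) (hu : u = normInf (Xᵀ.mulVec (Y - X.mulVec bT)))
    (bL : Fin p → ℝ) (hbL : IsLassoSol X Y u bL) :
    norm1 bT ≥ norm1 bL := by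
  rcases (norm1_nonneg bL).eq_or_lt with h0 | hpos
  · rw [← h0]
    exact norm1_nonneg bT
  have hupos : 0 < u := hu ▸ norm_pos_iff.mpr hbT.1
  have hle := hbL.le_normInf hpos
  have htrex := hbT.2 bL (norm_pos_iff.mp (hupos.trans_le hle))
  have hlasso := hbL bT
  rw [trexObj, trexObj, ← hu] at htrex
  have hmono : norm2sq (Y - X.mulVec bL) / (c * normInf (Xᵀ.mulVec (Y - X.mulVec bL))) ≤
      norm2sq (Y - X.mulVec bL) / (c * u) :=
    div_le_div_of_nonneg_left (norm2sq_nonneg _) (by positivity)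
      (mul_le_mul_of_nonneg_left hle hc.le)
  have hscaled : norm2sq (Y - X.mulVec bT) + c * u * norm1 bT ≤
      norm2sq (Y - X.mulVec bL) + c * u * norm1 bL := by
    have h := mul_le_mul_of_nonneg_left
      (htrex.trans (add_le_add_left hmono (norm1 bL))) (by positivity : 0 ≤ c * u)
    rwa [mul_add, mul_add, mul_div_cancel₀ _ (by positivity),
      mul_div_cancel₀ _ (by positivity)] at h
  have hfactor : 0 < (2 - c) * u := mul_pos (by linarith) hupos
  refine le_of_mul_le_mul_left ?_ hfactor
  linarith
end

section
/- Suppose ‖XᵀXβ*‖∞ ≥ (1 + 2/c)‖Xᵀε‖∞ (Assumption 2) and 2‖Xᵀε‖∞ ≥ cû. Then any TREX solution β̂ satisfies ‖Xβ̂ − Xβ*‖₂² ≤ (2 + 2/c)‖Xᵀε‖∞‖β*‖₁. -/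
open Matrix BigOperators Finset

theorem norm2sq_eq_dotProduct {m : ℕ} (v : Fin m → ℝ) : norm2sq v = v ⬝ᵥ v := by
  simp [norm2sq, dotProduct, sq]

/-- Hölder's inequality for the pair `ℓ∞`, `ℓ1`. -/
theorem abs_dotProduct_le_normInf_mul_norm1 {m : ℕ} (v w : Fin m → ℝ) :
    |v ⬝ᵥ w| ≤ normInf v * norm1 w := by
  unfold dotProduct normInf norm1
  rw [Finset.mul_sum]
  refine (Finset.abs_sum_le_sum_abs _ _).trans (Finset.sum_le_sum fun i _ => ?_)
  rw [abs_mul]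
  exact mul_le_mul_of_nonneg_right (norm_le_pi_norm v i) (abs_nonneg _)

theorem abs_dotProduct_mulVec_le {n p : ℕ} (X : Matrix (Fin n) (Fin p) ℝ)
    (v : Fin n → ℝ) (w : Fin p → ℝ) :
    |v ⬝ᵥ X.mulVec w| ≤ normInf (Xᵀ.mulVec v) * norm1 w := by
  rw [dotProduct_mulVec, ← mulVec_transpose]
  exact abs_dotProduct_le_normInf_mul_norm1 _ _

/-- Case 2 of the slow-rate bound for the TREX: under Assumption 2
(`‖XᵀXβ*‖∞ ≥ (1 + 2/c)‖Xᵀε‖∞`) and `2‖Xᵀε‖∞ ≥ cû`, any TREX solution `β̂` satisfies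
`‖Xβ̂ − Xβ*‖₂² ≤ (2 + 2/c)‖Xᵀε‖∞‖β*‖₁`. -/
theorem trex_slow_rate_case2 {n p : ℕ} (X : Matrix (Fin n) (Fin p) ℝ)
    (βs : Fin p → ℝ) (ε Y : Fin n → ℝ) (hY : Y = X.mulVec βs + ε)
    (c : ℝ) (hc : 0 < c) (hc2 : c < 2)
    (hA2 : normInf (Xᵀ.mulVec (X.mulVec βs)) ≥ (1 + 2 / c) * normInf (Xᵀ.mulVec ε))
    (bT : Fin p → ℝ) (hbT : IsTrexSol X Y c bT)
    (u : ℝ) (hu : u = normInf (Xᵀ.mulVec (Y - X.mulVec bT)))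
    (hcase : 2 * normInf (Xᵀ.mulVec ε) ≥ c * u) :
    norm2sq (X.mulVec bT - X.mulVec βs) ≤
      (2 + 2 / c) * normInf (Xᵀ.mulVec ε) * norm1 βs := by
  obtain ⟨hne, hmin⟩ := hbT
  set W := normInf (Xᵀ.mulVec ε) with hW
  set T := normInf (Xᵀ.mulVec Y) with hT
  have hu0 : 0 < u := by rw [hu]; exact norm_pos_iff.mpr hne
  have hW0 : 0 < W := by nlinarith [mul_pos hc hu0]
  have hTW : 2 / c * W ≤ T := by
    have h : normInf (Xᵀ.mulVec (X.mulVec βs)) ≤ T + W := by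
      have : Xᵀ.mulVec (X.mulVec βs) = Xᵀ.mulVec Y - Xᵀ.mulVec ε := by
        rw [hY, mulVec_add, add_sub_cancel_right]
      rw [this]
      exact norm_sub_le _ _
    linarith
  have hT0 : 0 < T := lt_of_lt_of_le (by positivity) hTW
  have hzero : norm2sq (Y - X.mulVec bT) / (c * u) + norm1 bT ≤ norm2sq Y / (c * T) := by
    have h := hmin 0 (by simpa using norm_pos_iff.mp hT0)
    simpa [trexObj, ← hu, ← hT, norm1] using h
  set l := 2 * W / (c * T) with hl
  have hl0 : 0 ≤ l := by positivity
  have hl1 : l ≤ 1 := by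
    rw [hl, div_le_one (by positivity)]
    have h := mul_le_mul_of_nonneg_left hTW hc.le
    have h' : c * (2 / c * W) = 2 * W := by field_simp
    linarith
  have hlT : l * T = 2 / c * W := by rw [hl]; field_simp
  have hr0 : 0 ≤ norm2sq (Y - X.mulVec bT) := Finset.sum_nonneg fun _ _ => sq_nonneg _
  have hscaled : norm2sq (Y - X.mulVec bT) + 2 * W * norm1 bT ≤ l * norm2sq Y := by
    have h := mul_le_mul_of_nonneg_left hzero (by positivity : 0 ≤ 2 * W)
    have h1 : norm2sq (Y - X.mulVec bT) ≤ 2 * W * (norm2sq (Y - X.mulVec bT) / (c * u)) := by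
      rw [mul_div_assoc', le_div_iff₀ (by positivity), mul_comm]
      exact mul_le_mul_of_nonneg_right hcase hr0
    have h2 : 2 * W * (norm2sq Y / (c * T)) = l * norm2sq Y := by rw [hl]; ring
    linarith
  have hεβ := abs_dotProduct_mulVec_le X ε βs
  have hεb := (le_abs_self _).trans (abs_dotProduct_mulVec_le X ε bT)
  have hYβ := (le_abs_self _).trans (abs_dotProduct_mulVec_le X Y βs)
  rw [← hW] at hεβ hεb
  rw [← hT] at hYβ
  have hYsq : norm2sq Y = norm2sq ε + ε ⬝ᵥ X.mulVec βs + Y ⬝ᵥ X.mulVec βs := by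
    simp only [norm2sq_eq_dotProduct, hY, dotProduct_add, add_dotProduct,
      dotProduct_comm (X.mulVec βs) ε]
    ring
  have hres : norm2sq (Y - X.mulVec bT) = norm2sq ε - 2 * (ε ⬝ᵥ X.mulVec bT)
      + 2 * (ε ⬝ᵥ X.mulVec βs) + norm2sq (X.mulVec bT - X.mulVec βs) := by
    simp only [norm2sq_eq_dotProduct, hY, dotProduct_add, add_dotProduct, dotProduct_sub,
      sub_dotProduct, dotProduct_comm (X.mulVec βs) ε, dotProduct_comm (X.mulVec bT) ε,
      dotProduct_comm (X.mulVec bT) (X.mulVec βs)]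
    ring
  have hε0 : 0 ≤ norm2sq ε := Finset.sum_nonneg fun _ _ => sq_nonneg _
  have hlε : l * norm2sq ε ≤ norm2sq ε := mul_le_of_le_one_left hε0 hl1
  have hlY : l * (Y ⬝ᵥ X.mulVec βs) ≤ 2 / c * W * norm1 βs := by
    rw [← hlT, mul_assoc]
    exact mul_le_mul_of_nonneg_left hYβ hl0
  have hcross : (l - 2) * (ε ⬝ᵥ X.mulVec βs) ≤ 2 * (W * norm1 βs) := by
    have h1 := mul_le_mul_of_nonneg_left ((neg_le_abs _).trans hεβ) (by linarith : 0 ≤ 2 - l)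
    have h2 := mul_nonneg hl0 (mul_nonneg hW0.le (norm1_nonneg βs))
    linarith
  rw [hYsq, hres] at hscaled
  linarith
end
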